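/- arXiv:2310.09516 — 2 statements merged into one kernel-verified Lean document; each statement's English description precedes it below -/
import Mathlib

section
/- If λ_K · δ_max < K, where δ_max is the largest eigenvalue of L⁻, then the energy ℓ(Y) = ‖Y − B‖_F² + λ·tr(Yᵀ L Y) − (λ_K/K)·tr(Yᵀ L⁻ Y) has a unique global minimizer over Y ∈ ℝ^{n×d}. -/
open Matrix

/-- The node-embedding energy
`ℓ(Y) = ‖Y − B‖_F² + λ·tr(Yᵀ L Y) − (λ_K/K)·tr(Yᵀ L⁻ Y)`,
where `‖Y − B‖_F² = tr((Y−B)ᵀ(Y−B))`. -/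
noncomputable def energy {n d : ℕ} (L Lneg : Matrix (Fin n) (Fin n) ℝ)
    (B : Matrix (Fin n) (Fin d) ℝ) (lam lamK : ℝ) (K : ℕ)
    (Y : Matrix (Fin n) (Fin d) ℝ) : ℝ :=
  ((Y - B)ᵀ * (Y - B)).trace + lam * (Yᵀ * L * Y).trace
    - (lamK / K) * (Yᵀ * Lneg * Y).trace

/-- A Hermitian matrix is bounded above, in the Loewner order, by any upper bound of its
eigenvalues. -/
theorem Matrix.IsHermitian.posSemidef_smul_one_sub {m : Type*} [Fintype m] [DecidableEq m]
    {A : Matrix m m ℝ} (hA : A.IsHermitian) {c : ℝ} (hc : ∀ i, hA.eigenvalues i ≤ c) :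
    (c • (1 : Matrix m m ℝ) - A).PosSemidef := by
  have hsub : c • (1 : Matrix m m ℝ) - A = Unitary.conjStarAlgAut ℝ _ hA.eigenvectorUnitary
      (diagonal fun i => c - hA.eigenvalues i) := by
    have hdiag : (diagonal fun i => c - hA.eigenvalues i)
        = c • (1 : Matrix m m ℝ) - diagonal (RCLike.ofReal ∘ hA.eigenvalues) := by
      rw [smul_one_eq_diagonal, diagonal_sub]
      rfl
    rw [hdiag, map_sub, map_smul, map_one, ← hA.spectral_theorem]
  rw [hsub, Unitary.conjStarAlgAut_apply]
  exact (PosSemidef.diagonal fun i => sub_nonneg.2 (hc i)).mul_mul_conjTranspose_same _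

theorem Matrix.PosDef.trace_transpose_mul_mul_same_pos {m k : Type*} [Fintype m] [Fintype k]
    {A : Matrix m m ℝ} (hA : A.PosDef) {D : Matrix m k ℝ} (hD : D ≠ 0) :
    0 < (Dᵀ * A * D).trace := by
  have hsum : (Dᵀ * A * D).trace = ∑ j, star (D.col j) ⬝ᵥ (A *ᵥ D.col j) := by
    refine Finset.sum_congr rfl fun j _ => ?_
    rw [Matrix.mul_assoc]
    rfl
  obtain ⟨i, j, hij⟩ : ∃ i j, D i j ≠ 0 := by
    by_contra! h
    exact hD (Matrix.ext h)
  rw [hsum]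
  refine Finset.sum_pos' (fun j _ => hA.posSemidef.dotProduct_mulVec_nonneg _)
    ⟨j, Finset.mem_univ j, hA.dotProduct_mulVec_pos fun h => hij (congrFun h i)⟩

theorem energyMatrix_posDef {m : Type*} [Fintype m] [DecidableEq m] {L N : Matrix m m ℝ}
    (hL : L.PosSemidef) (hN : N.IsHermitian) {lam c δ : ℝ} (hlam : 0 ≤ lam) (hc : 0 ≤ c)
    (hδ : ∀ i, hN.eigenvalues i ≤ δ) (hcδ : c * δ < 1) :
    (1 + lam • L - c • N).PosDef := by
  have hsplit : 1 + lam • L - c • N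
      = (1 - c * δ) • (1 : Matrix m m ℝ) + (lam • L + c • (δ • (1 : Matrix m m ℝ) - N)) := by
    module
  rw [hsplit]
  exact (PosDef.one.smul (sub_pos.2 hcδ)).add_posSemidef
    ((hL.smul hlam).add ((hN.posSemidef_smul_one_sub hδ).smul hc))

/-- Completing the square at a solution `Z` of the stationarity equation. -/
theorem energy_eq_add_trace {n d : ℕ} {L N : Matrix (Fin n) (Fin n) ℝ}
    {B : Matrix (Fin n) (Fin d) ℝ} {lam lamK : ℝ} {K : ℕ}
    (hA : (1 + lam • L - (lamK / K) • N).IsSymm) {Z : Matrix (Fin n) (Fin d) ℝ}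
    (hZ : (1 + lam • L - (lamK / K) • N) * Z = B) (Y : Matrix (Fin n) (Fin d) ℝ) :
    energy L N B lam lamK K Y = energy L N B lam lamK K Z
      + ((Y - Z)ᵀ * (1 + lam • L - (lamK / K) • N) * (Y - Z)).trace := by
  have hexpand : ∀ W : Matrix (Fin n) (Fin d) ℝ, energy L N B lam lamK K W
      = (Wᵀ * (1 + lam • L - (lamK / K) • N) * W).trace - 2 * (Wᵀ * B).trace
        + (Bᵀ * B).trace := by
    intro W
    have hBW : (Bᵀ * W).trace = (Wᵀ * B).trace := by
      rw [← trace_transpose, transpose_mul, transpose_transpose]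
    simp only [energy, transpose_sub, Matrix.mul_sub, Matrix.sub_mul, Matrix.mul_add,
      Matrix.add_mul, Matrix.mul_smul, Matrix.smul_mul, Matrix.mul_one, trace_sub, trace_add,
      trace_smul, smul_eq_mul, hBW]
    ring
  rw [hexpand, hexpand]
  generalize 1 + lam • L - (lamK / K) • N = A at hA hZ
  subst hZ
  have hcross : (Zᵀ * (A * Y)).trace = (Yᵀ * (A * Z)).trace := by
    rw [← trace_transpose, transpose_mul, transpose_mul, transpose_transpose, hA.eq,
      Matrix.mul_assoc]
  simp only [transpose_sub, Matrix.mul_sub, Matrix.sub_mul, Matrix.mul_assoc, trace_sub, hcross]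
  ring

/-- if `λ_K · δ_max < K`, where `δ_max` is the largest eigenvalue of `L⁻`,
then the energy has a unique global minimizer over `Y ∈ ℝ^{n×d}`. -/
theorem energy_exists_unique_global_min {n d : ℕ}
    (L Lneg : Matrix (Fin n) (Fin n) ℝ)
    (hL : L.PosSemidef) (hLneg : Lneg.PosSemidef)
    (B : Matrix (Fin n) (Fin d) ℝ)
    (lam lamK : ℝ) (hlam : 0 < lam) (hlamK : 0 ≤ lamK)
    (K : ℕ) (hK : 1 ≤ K)
    (δmax : ℝ) (hδ : IsGreatest (Set.range hLneg.isHermitian.eigenvalues) δmax)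
    (hcond : lamK * δmax < (K : ℝ)) :
    ∃! Ystar : Matrix (Fin n) (Fin d) ℝ,
      ∀ Y : Matrix (Fin n) (Fin d) ℝ,
        energy L Lneg B lam lamK K Ystar ≤ energy L Lneg B lam lamK K Y := by
  have hK_pos : (0 : ℝ) < K := by exact_mod_cast hK
  have hA : (1 + lam • L - (lamK / K) • Lneg).PosDef :=
    energyMatrix_posDef hL hLneg.isHermitian hlam.le (div_nonneg hlamK hK_pos.le)
      (fun i => hδ.2 ⟨i, rfl⟩) (by rwa [div_mul_eq_mul_div, div_lt_one hK_pos])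
  obtain ⟨Z, hZ⟩ : ∃ Z, (1 + lam • L - (lamK / K) • Lneg) * Z = B :=
    ⟨_, mul_nonsing_inv_cancel_left _ B ((isUnit_iff_isUnit_det _).1 hA.isUnit)⟩
  have hsq := energy_eq_add_trace (isHermitian_iff_isSymm.1 hA.isHermitian) hZ
  refine ⟨Z, fun Y => ?_, fun Y hY => ?_⟩
  · rw [hsq Y]
    exact le_add_of_nonneg_right
      (hA.posSemidef.conjTranspose_mul_mul_same _).trace_nonneg
  · by_contra hne
    have hle := hY Z
    rw [hsq Y] at hle
    have hpos := hA.trace_transpose_mul_mul_same_pos (sub_ne_zero.2 hne)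
    exact (lt_add_of_pos_right _ hpos).not_ge hle
end

section
/- If there exists a unit vector v ∈ ℝⁿ with λ·vᵀLv − (λ_K/K)·vᵀL⁻v < −1, then the energy ℓ is unbounded from below, i.e., inf over Y ∈ ℝ^{n×d} of ℓ(Y) is −∞ (witnessed along Y = t·v·e₁ᵀ as t → ∞, where e₁ is the first standard basis vector of ℝ^d). This shows the un-bounded energy (4) of the paper need not be lower bounded without further conditions. -/
open Matrix Filter

/-- The quadratic form of `M` at the rank-one matrix `v wᵀ`. -/
theorem trace_transpose_vecMulVec_mul_mul_vecMulVec {n d : ℕ} (M : Matrix (Fin n) (Fin n) ℝ)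
    (v : Fin n → ℝ) (w : Fin d → ℝ) :
    ((vecMulVec v w)ᵀ * M * vecMulVec v w).trace = (v ⬝ᵥ M *ᵥ v) * (w ⬝ᵥ w) := by
  rw [transpose_vecMulVec, vecMulVec_mul, vecMulVec_mul_vecMulVec, trace_vecMulVec,
    dotProduct_smul, smul_eq_mul, dotProduct_mulVec]

/-- Along a line spanned by a rank-one matrix the energy is a quadratic polynomial. -/
theorem energy_smul_vecMulVec {n d : ℕ} (L Lneg : Matrix (Fin n) (Fin n) ℝ)
    (B : Matrix (Fin n) (Fin d) ℝ) (lam lamK : ℝ) (K : ℕ) (v : Fin n → ℝ) (w : Fin d → ℝ)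
    (t : ℝ) :
    energy L Lneg B lam lamK K (t • vecMulVec v w) =
      (v ⬝ᵥ v + lam * (v ⬝ᵥ L *ᵥ v) - (lamK / K) * (v ⬝ᵥ Lneg *ᵥ v)) * (w ⬝ᵥ w) * t ^ 2
        + -2 * (Bᵀ * vecMulVec v w).trace * t + (Bᵀ * B).trace := by
  have h := trace_transpose_vecMulVec_mul_mul_vecMulVec 1 v w
  rw [Matrix.mul_one, one_mulVec] at h
  have hB : ((vecMulVec v w)ᵀ * B).trace = (Bᵀ * vecMulVec v w).trace := by
    rw [← trace_transpose, transpose_mul, transpose_transpose]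
  simp only [energy, transpose_sub, transpose_smul, Matrix.sub_mul, Matrix.mul_sub,
    Matrix.smul_mul, Matrix.mul_smul, trace_sub, trace_smul, smul_eq_mul,
    trace_transpose_vecMulVec_mul_mul_vecMulVec, h, hB]
  ring

/-- A real quadratic polynomial with negative leading coefficient tends to `-∞`. -/
theorem tendsto_quadratic_atBot {a : ℝ} (ha : a < 0) (b c : ℝ) :
    Tendsto (fun t : ℝ => a * t ^ 2 + b * t + c) atTop atBot := by
  have h : Tendsto (fun t : ℝ => t * (a * t + b) + c) atTop atBot :=
    tendsto_atBot_add_const_right _ c <| tendsto_id.atTop_mul_atBot₀ <|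
      tendsto_atBot_add_const_right _ b <| tendsto_id.const_mul_atTop_of_neg ha
  exact h.congr fun t => by ring

/-- if there exists a unit vector `v ∈ ℝⁿ` with
`λ·vᵀLv − (λ_K/K)·vᵀL⁻v < −1`, then the energy `ℓ` is unbounded from below
(its infimum over `Y` is `−∞`), witnessed along `Y = t·v·e₁ᵀ` as `t → ∞`,
where `e₁` is the first standard basis vector of `ℝ^d`. -/
theorem energy_unbounded_below {n d : ℕ} (hd : 0 < d)
    (L Lneg : Matrix (Fin n) (Fin n) ℝ)
    (hL : L.PosSemidef) (hLneg : Lneg.PosSemidef)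
    (B : Matrix (Fin n) (Fin d) ℝ)
    (lam lamK : ℝ) (hlam : 0 < lam) (hlamK : 0 ≤ lamK)
    (K : ℕ) (hK : 1 ≤ K)
    (v : Fin n → ℝ) (hv : v ⬝ᵥ v = 1)
    (hneg : lam * (v ⬝ᵥ L *ᵥ v) - (lamK / K) * (v ⬝ᵥ Lneg *ᵥ v) < -1) :
    (∀ c : ℝ, ∃ Y : Matrix (Fin n) (Fin d) ℝ, energy L Lneg B lam lamK K Y < c) ∧
    Tendsto
      (fun t : ℝ =>
        energy L Lneg B lam lamK K
          (t • Matrix.vecMulVec v (fun j => if j = (⟨0, hd⟩ : Fin d) then 1 else 0)))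
      atTop atBot := by
  have htends : Tendsto
      (fun t : ℝ =>
        energy L Lneg B lam lamK K
          (t • Matrix.vecMulVec v (fun j => if j = (⟨0, hd⟩ : Fin d) then 1 else 0)))
      atTop atBot := by
    simp only [energy_smul_vecMulVec]
    refine tendsto_quadratic_atBot ?_ _ _
    have hw : (fun j => if j = (⟨0, hd⟩ : Fin d) then (1 : ℝ) else 0) ⬝ᵥ
        (fun j => if j = (⟨0, hd⟩ : Fin d) then 1 else 0) = 1 := by
      simp [dotProduct]
    rw [hw, hv]
    linarith
  refine ⟨fun c => ?_, htends⟩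
  obtain ⟨t, ht⟩ := (htends.eventually_lt_atBot c).exists
  exact ⟨_, ht⟩
end
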